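/- (Nonexistence of equivariant maps from Δ_{r,r-1} * [r] to the sphere.) Let r be a prime number or r = 4. Then there is no continuous S_r-equivariant map from the configuration space C₁ to the sphere S^{r-2}, where S^{r-2} = {y : Fin r → ℝ | ∑ i, y i = 0 ∧ ‖y‖ = 1} with S_r acting by permuting coordinates ((σ·y) i = y (σ⁻¹ i)), and equivariance means f(σ·M) = σ·f(M) for all σ ∈ S_r and M ∈ C₁. -/

import Mathlib

/-- The configuration space `C₁`, the geometric realization of the chessboard
complex `Δ_{r,r-1} * [r]`: matrices with nonnegative entries summing to `1`,
at most one nonzero entry in each column, and at most one nonzero entry in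
each row among the columns other than the last one. -/
def ConfC1 (r : ℕ) : Set (Fin r → Fin r → ℝ) :=
  {M | (∀ b t, 0 ≤ M b t) ∧ (∑ b, ∑ t, M b t) = 1 ∧
    (∀ t b b', M b t ≠ 0 → M b' t ≠ 0 → b = b') ∧
    (∀ (b : Fin r) (t t' : Fin r), (t : ℕ) + 1 < r → (t' : ℕ) + 1 < r →
      M b t ≠ 0 → M b t' ≠ 0 → t = t')}

/-- The action of `σ ∈ S_r` on configuration spaces of matrices,
permuting the rows (boxes). -/
def rowPerm {r m : ℕ} (σ : Equiv.Perm (Fin r)) (M : Fin r → Fin m → ℝ) :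
    Fin r → Fin m → ℝ :=
  fun b t => M (σ⁻¹ b) t

open Finset Filter Topology

noncomputable section

namespace OrderedChain

/-- Ordered chains: integer combinations of `m`-tuples of vertices, with `m = 0` allowed. -/
abbrev Chain (V : Type*) (m : ℕ) := (Fin m → V) →₀ ℤ

variable {V W : Type*} {m : ℕ}

/-- The (augmented) boundary operator. -/
def bd (V : Type*) (m : ℕ) : Chain V (m + 1) →ₗ[ℤ] Chain V m :=
  Finsupp.linearCombination ℤ fun v =>
    ∑ i : Fin (m + 1), (-1 : ℤ) ^ (i : ℕ) • Finsupp.single (fun j => v (i.succAbove j)) 1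

/-- Join with a vertex. -/
def cone (a : V) (m : ℕ) : Chain V m →ₗ[ℤ] Chain V (m + 1) :=
  Finsupp.lmapDomain ℤ ℤ fun v => Fin.cons a v

/-- The map of chains induced by a map of vertices. -/
def push (f : V → W) (m : ℕ) : Chain V m →ₗ[ℤ] Chain W m :=
  Finsupp.lmapDomain ℤ ℤ fun v => f ∘ v

@[simp] lemma bd_single (v : Fin (m + 1) → V) :
    bd V m (Finsupp.single v 1) =
      ∑ i : Fin (m + 1), (-1 : ℤ) ^ (i : ℕ) • Finsupp.single (fun j => v (i.succAbove j)) 1 := by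
  simp [bd]

@[simp] lemma cone_single (a : V) (v : Fin m → V) (c : ℤ) :
    cone a m (Finsupp.single v c) = Finsupp.single (Fin.cons a v : Fin (m + 1) → V) c := by
  simp [cone]

@[simp] lemma push_single (f : V → W) (v : Fin m → V) (c : ℤ) :
    push f m (Finsupp.single v c) = Finsupp.single (f ∘ v) c := by
  simp [push]

lemma chain_hom_ext {A : Type*} [AddCommGroup A] {F G : Chain V m →ₗ[ℤ] A}
    (h : ∀ v, F (Finsupp.single v 1) = G (Finsupp.single v 1)) : F = G :=
  Finsupp.lhom_ext' fun v => LinearMap.ext_ring (h v)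

lemma bd_cone_zero (a : V) (z : Chain V 0) : bd V 0 (cone a 0 z) = z := by
  suffices h : (bd V 0) ∘ₗ cone a 0 = LinearMap.id from LinearMap.congr_fun h z
  refine chain_hom_ext fun v => ?_
  simp [Subsingleton.elim v (fun j => Fin.elim0 j)]

lemma bd_cone (a : V) (z : Chain V (m + 1)) :
    bd V (m + 1) (cone a (m + 1) z) = z - cone a m (bd V m z) := by
  suffices h : (bd V (m + 1)) ∘ₗ cone a (m + 1) = LinearMap.id - cone a m ∘ₗ bd V m from
    LinearMap.congr_fun h z
  refine chain_hom_ext fun v => ?_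
  simp only [LinearMap.comp_apply, cone_single, bd_single, LinearMap.sub_apply, LinearMap.id_apply]
  rw [Fin.sum_univ_succ, map_sum, sub_eq_add_neg, ← Finset.sum_neg_distrib]
  congr 1
  · simp
  · refine Finset.sum_congr rfl fun i _ => ?_
    rw [map_smul, cone_single, Fin.val_succ, pow_succ, mul_neg_one, neg_smul]
    congr 4
    funext j
    refine Fin.cases ?_ (fun j => ?_) j <;> simp

lemma bd_bd (z : Chain V (m + 2)) : bd V m (bd V (m + 1) z) = 0 := by
  suffices h : bd V m ∘ₗ bd V (m + 1) = 0 from LinearMap.congr_fun h z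
  induction m with
  | zero =>
    refine chain_hom_ext fun v => ?_
    rw [← Fin.cons_self_tail v, ← cone_single, LinearMap.comp_apply, bd_cone, map_sub,
      bd_cone_zero, sub_self]
    rfl
  | succ m ih =>
    refine chain_hom_ext fun v => ?_
    have h := LinearMap.congr_fun (ih (Finsupp.single (Fin.tail v) 1)) (Finsupp.single (Fin.tail v) 1)
    rw [LinearMap.comp_apply] at h
    rw [← Fin.cons_self_tail v, ← cone_single, LinearMap.comp_apply, bd_cone, map_sub,
      bd_cone, h]
    simp

lemma bd_push (f : V → W) (z : Chain V (m + 1)) :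
    bd W m (push f (m + 1) z) = push f m (bd V m z) := by
  suffices h : bd W m ∘ₗ push f (m + 1) = push f m ∘ₗ bd V m from LinearMap.congr_fun h z
  refine chain_hom_ext fun v => ?_
  simp only [LinearMap.comp_apply, push_single, bd_single, map_sum, map_smul]
  rfl

lemma push_cone (f : V → W) (a : V) (z : Chain V m) :
    push f (m + 1) (cone a m z) = cone (f a) m (push f m z) := by
  suffices h : push f (m + 1) ∘ₗ cone a m = cone (f a) m ∘ₗ push f m from LinearMap.congr_fun h z
  refine chain_hom_ext fun v => ?_
  simp only [LinearMap.comp_apply, push_single, cone_single, Fin.comp_cons]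

lemma push_push {U : Type*} (f : V → W) (g : W → U) (z : Chain V m) :
    push g m (push f m z) = push (g ∘ f) m z := by
  suffices h : push g m ∘ₗ push f m = push (g ∘ f) m from LinearMap.congr_fun h z
  refine chain_hom_ext fun v => ?_
  simp only [LinearMap.comp_apply, push_single]
  rfl

/-- The chain homotopy between two augmentation preserving chain maps which is built by coning
off with a vertex chosen from the first vertex of each simplex. -/
def htpy (apex : V → W) (Φ Ψ : ∀ m, Chain V m →ₗ[ℤ] Chain W m) :
    ∀ m, Chain V m →ₗ[ℤ] Chain W (m + 1)
  | 0 => 0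
  | m + 1 => Finsupp.linearCombination ℤ fun v => cone (apex (v 0)) (m + 1)
      (Φ (m + 1) (Finsupp.single v 1) - Ψ (m + 1) (Finsupp.single v 1)
        - htpy apex Φ Ψ m (bd V m (Finsupp.single v 1)))

lemma htpy_single (apex : V → W) (Φ Ψ : ∀ m, Chain V m →ₗ[ℤ] Chain W m) (v : Fin (m + 1) → V) :
    htpy apex Φ Ψ (m + 1) (Finsupp.single v 1) = cone (apex (v 0)) (m + 1)
      (Φ (m + 1) (Finsupp.single v 1) - Ψ (m + 1) (Finsupp.single v 1)
        - htpy apex Φ Ψ m (bd V m (Finsupp.single v 1))) := by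
  rw [htpy, Finsupp.linearCombination_single, one_smul]

lemma bd_htpy (apex : V → W) (Φ Ψ : ∀ m, Chain V m →ₗ[ℤ] Chain W m)
    (hΦ : ∀ m z, bd W m (Φ (m + 1) z) = Φ m (bd V m z))
    (hΨ : ∀ m z, bd W m (Ψ (m + 1) z) = Ψ m (bd V m z)) (h0 : Φ 0 = Ψ 0) (z : Chain V (m + 1)) :
    bd W (m + 1) (htpy apex Φ Ψ (m + 1) z) =
      Φ (m + 1) z - Ψ (m + 1) z - htpy apex Φ Ψ m (bd V m z) := by
  suffices h : bd W (m + 1) ∘ₗ htpy apex Φ Ψ (m + 1) =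
      Φ (m + 1) - Ψ (m + 1) - htpy apex Φ Ψ m ∘ₗ bd V m from LinearMap.congr_fun h z
  clear z
  induction m with
  | zero =>
    refine chain_hom_ext fun v => ?_
    rw [LinearMap.comp_apply, htpy_single, bd_cone]
    simp only [map_sub, hΦ, hΨ, h0, htpy, LinearMap.sub_apply, LinearMap.comp_apply,
      LinearMap.zero_apply, map_zero, sub_zero, sub_self]
  | succ m ih =>
    refine chain_hom_ext fun v => ?_
    have h := LinearMap.congr_fun ih (bd V (m + 1) (Finsupp.single v 1))
    rw [LinearMap.comp_apply] at h
    rw [LinearMap.comp_apply, htpy_single, bd_cone, map_sub (bd W (m + 1)), h]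
    simp only [map_sub, hΦ, hΨ, LinearMap.sub_apply, LinearMap.comp_apply, bd_bd, map_zero,
      sub_zero, sub_self]

section Subdivision

variable {E : Type*} [NormedAddCommGroup E] [NormedSpace ℝ E]

/-- The barycentre of a tuple of points. -/
def bary (v : Fin (m + 1) → E) : E := ((m : ℝ) + 1)⁻¹ • ∑ i, v i

/-- Barycentric subdivision of affine chains. -/
def sd (E : Type*) [NormedAddCommGroup E] [NormedSpace ℝ E] : ∀ m, Chain E m →ₗ[ℤ] Chain E m
  | 0 => LinearMap.id
  | m + 1 => Finsupp.linearCombination ℤ fun v =>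
      cone (bary v) m (sd E m (bd E m (Finsupp.single v 1)))

lemma sd_single (v : Fin (m + 1) → E) :
    sd E (m + 1) (Finsupp.single v 1) =
      cone (bary v) m (sd E m (bd E m (Finsupp.single v 1))) := by
  rw [sd, Finsupp.linearCombination_single, one_smul]

lemma bd_sd (z : Chain E (m + 1)) : bd E m (sd E (m + 1) z) = sd E m (bd E m z) := by
  suffices h : bd E m ∘ₗ sd E (m + 1) = sd E m ∘ₗ bd E m from LinearMap.congr_fun h z
  clear z
  induction m with
  | zero =>
    refine chain_hom_ext fun v => ?_
    rw [LinearMap.comp_apply, sd_single, bd_cone_zero, LinearMap.comp_apply]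
  | succ m ih =>
    refine chain_hom_ext fun v => ?_
    have h := LinearMap.congr_fun ih (bd E (m + 1) (Finsupp.single v 1))
    rw [LinearMap.comp_apply] at h
    rw [LinearMap.comp_apply, sd_single, bd_cone, h]
    simp only [LinearMap.comp_apply, bd_bd, map_zero, sub_zero]

lemma bd_sd_pow (N : ℕ) (z : Chain E (m + 1)) :
    bd E m ((sd E (m + 1) ^ N) z) = (sd E m ^ N) (bd E m z) := by
  induction N with
  | zero => simp
  | succ N ih => rw [pow_succ', pow_succ', Module.End.mul_apply, Module.End.mul_apply, bd_sd, ih]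

lemma bary_mem_convexHull (v : Fin (m + 1) → E) : bary v ∈ convexHull ℝ (Set.range v) := by
  rw [bary, Finset.smul_sum]
  refine (convex_convexHull ℝ _).sum_mem (fun _ _ => by positivity) ?_
    fun i _ => subset_convexHull ℝ _ ⟨i, rfl⟩
  simp
  field_simp

lemma dist_bary_le (v : Fin (m + 1) → E) {d : ℝ} (hd : ∀ i j, dist (v i) (v j) ≤ d)
    (j : Fin (m + 1)) : dist (v j) (bary v) ≤ (1 - ((m : ℝ) + 1)⁻¹) * d := by
  have h1 : v j - bary v = ((m : ℝ) + 1)⁻¹ • ∑ i, (v j - v i) := by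
    rw [bary, Finset.sum_sub_distrib, smul_sub]
    congr 1
    simp only [sum_const, card_univ, Fintype.card_fin]
    rw [← Nat.cast_smul_eq_nsmul ℝ, smul_smul]
    push_cast
    rw [inv_mul_cancel₀ (by positivity), one_smul]
  have h2 : ‖∑ i, (v j - v i)‖ ≤ m * d := by
    rw [← Finset.add_sum_erase _ _ (Finset.mem_univ j), sub_self, zero_add]
    refine (norm_sum_le_of_le _ (f := fun i => v j - v i) (n := fun _ => d) fun i _ => ?_).trans ?_
    · rw [← dist_eq_norm]; exact hd j i
    · simp
  rw [dist_eq_norm, h1, norm_smul, Real.norm_of_nonneg (by positivity)]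
  calc ((m : ℝ) + 1)⁻¹ * ‖∑ i, (v j - v i)‖ ≤ ((m : ℝ) + 1)⁻¹ * (m * d) := by gcongr
    _ = _ := by field_simp; ring

/-- The subdivision of a simplex is supported on small simplices in its convex hull. -/
lemma sd_single_mem_supported (v : Fin m → E) {d : ℝ} (hd : ∀ i j, dist (v i) (v j) ≤ d) :
    sd E m (Finsupp.single v 1) ∈ Finsupp.supported ℤ ℤ
      {w | (∀ i, w i ∈ convexHull ℝ (Set.range v)) ∧
        ∀ i j, dist (w i) (w j) ≤ (1 - (m : ℝ)⁻¹) * d} := by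
  classical
  induction m with
  | zero =>
    rw [Finsupp.mem_supported]
    intro w _
    exact ⟨fun i => i.elim0, fun i => i.elim0⟩
  | succ m ih =>
    have hd0 : 0 ≤ d := dist_nonneg.trans (hd 0 0)
    rw [sd_single, bd_single, map_sum, map_sum]
    refine Submodule.sum_mem _ fun k _ => ?_
    rw [map_smul, map_smul]
    refine Submodule.smul_mem _ _ ?_
    have h := ih (fun j => v (k.succAbove j)) fun i j => hd _ _
    have hsub : Set.range (fun j => v (k.succAbove j)) ⊆ Set.range v := by
      rintro _ ⟨j, rfl⟩; exact ⟨_, rfl⟩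
    rw [Finsupp.mem_supported] at h ⊢
    intro w hw
    obtain ⟨u, hu, rfl⟩ : ∃ u ∈ (sd E m (Finsupp.single (fun j => v (k.succAbove j)) 1)).support,
        Fin.cons (bary v) u = w := by
      simpa using Finsupp.mapDomain_support hw
    obtain ⟨hu1, hu2⟩ := h hu
    have hu3 : ∀ i, u i ∈ convexHull ℝ (Set.range v) := fun i => convexHull_mono hsub (hu1 i)
    have hball : convexHull ℝ (Set.range v) ⊆
        Metric.closedBall (bary v) ((1 - ((m : ℝ) + 1)⁻¹) * d) := by
      refine convexHull_min ?_ (convex_closedBall _ _)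
      rintro _ ⟨j, rfl⟩
      exact dist_bary_le v hd j
    have hnn : 0 ≤ (1 - ((m : ℝ) + 1)⁻¹) * d := dist_nonneg.trans (dist_bary_le v hd 0)
    refine ⟨fun i => ?_, fun i j => ?_⟩
    · refine Fin.cases ?_ (fun i => ?_) i
      · exact bary_mem_convexHull v
      · exact hu3 i
    · push_cast
      refine Fin.cases ?_ (fun i => ?_) i <;> refine Fin.cases ?_ (fun j => ?_) j
      · simpa using hnn
      · simpa [dist_comm] using hball (hu3 j)
      · simpa using hball (hu3 i)
      · refine (hu2 i j).trans ?_
        have hm : 0 < m := i.pos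
        gcongr
        linarith

lemma sd_pow_single_mem_supported (v : Fin m → E) {d : ℝ} (hd : ∀ i j, dist (v i) (v j) ≤ d)
    (N : ℕ) : (sd E m ^ N) (Finsupp.single v 1) ∈ Finsupp.supported ℤ ℤ
      {w | (∀ i, w i ∈ convexHull ℝ (Set.range v)) ∧
        ∀ i j, dist (w i) (w j) ≤ (1 - (m : ℝ)⁻¹) ^ N * d} := by
  induction N with
  | zero =>
    refine Finsupp.single_mem_supported ℤ _ ⟨fun i => subset_convexHull ℝ _ ⟨i, rfl⟩, ?_⟩
    simpa using hd
  | succ N ih =>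
    rw [pow_succ' (sd E m), Module.End.mul_apply, ← Finsupp.sum_single ((sd E m ^ N) (Finsupp.single v 1)),
      Finsupp.sum, map_sum]
    refine Submodule.sum_mem _ fun w hw => ?_
    rw [← Finsupp.smul_single_one, map_smul]
    refine Submodule.smul_mem _ _ ?_
    rw [Finsupp.mem_supported] at ih
    obtain ⟨hw1, hw2⟩ := ih hw
    refine Finsupp.supported_mono ?_ (sd_single_mem_supported w hw2)
    rintro u ⟨hu1, hu2⟩
    refine ⟨fun i => ?_, fun i j => (hu2 i j).trans_eq (by ring)⟩
    refine convexHull_min ?_ (convex_convexHull ℝ _) (hu1 i)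
    rintro _ ⟨j, rfl⟩
    exact hw1 j

end Subdivision

lemma map_eq_of_mem_supported {A : Type*} [AddCommGroup A] {F G : Chain V m →ₗ[ℤ] A}
    {S : Set (Fin m → V)} (h : ∀ v ∈ S, F (Finsupp.single v 1) = G (Finsupp.single v 1))
    {z : Chain V m} (hz : z ∈ Finsupp.supported ℤ ℤ S) : F z = G z := by
  rw [Finsupp.supported_eq_span_single] at hz
  refine LinearMap.eqOn_span ?_ hz
  rintro _ ⟨v, hv, rfl⟩
  exact h v hv


section Orientation

variable {n : ℕ}

/-- The signed number of full-dimensional simplices of a chain of labels. -/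
def orient (n : ℕ) : Chain (Fin n) n →ₗ[ℤ] ℤ :=
  Finsupp.linearCombination ℤ fun v =>
    Matrix.det (Matrix.of fun i j : Fin n => if v i = j then (1 : ℤ) else 0)

lemma orient_single (v : Fin n → Fin n) : orient n (Finsupp.single v 1) =
    Matrix.det (Matrix.of fun i j : Fin n => if v i = j then (1 : ℤ) else 0) := by
  simp [orient]

lemma orient_single_eq_zero {v : Fin n → Fin n} (hv : ¬ Function.Surjective v) :
    orient n (Finsupp.single v 1) = 0 := by
  rw [orient_single]
  simp only [Function.Surjective, not_forall, not_exists] at hv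
  obtain ⟨j, hj⟩ := hv
  exact Matrix.det_eq_zero_of_column_eq_zero j fun i => by simp [hj i]

lemma orient_single_perm (σ : Equiv.Perm (Fin n)) :
    orient n (Finsupp.single (σ : Fin n → Fin n) 1) = Equiv.Perm.sign σ := by
  rw [orient_single]
  have h := Matrix.det_permute σ (1 : Matrix (Fin n) (Fin n) ℤ)
  rw [Matrix.det_one, mul_one, Int.cast_id] at h
  rw [← h]
  congr 1

lemma orient_push_perm (g : Equiv.Perm (Fin n)) (z : Chain (Fin n) n) :
    orient n (push g n z) = Equiv.Perm.sign g * orient n z := by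
  suffices h : orient n ∘ₗ push g n = (Equiv.Perm.sign g : ℤ) • orient n by
    simpa using LinearMap.congr_fun h z
  refine chain_hom_ext fun v => ?_
  rw [LinearMap.comp_apply, push_single, LinearMap.smul_apply, orient_single, orient_single,
    smul_eq_mul, ← Equiv.Perm.sign_inv g]
  refine Eq.trans ?_ (Matrix.det_permute' g⁻¹ _)
  congr 1
  ext i j
  simp [Equiv.eq_symm_apply]

lemma orient_bd (z : Chain (Fin n) (n + 1)) : orient n (bd (Fin n) n z) = 0 := by
  suffices h : orient n ∘ₗ bd (Fin n) n = 0 from LinearMap.congr_fun h z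
  refine chain_hom_ext fun v => ?_
  let B : Matrix (Fin (n + 1)) (Fin (n + 1)) ℤ :=
    Matrix.of fun i => Fin.cons 1 fun j => if v i = j then (1 : ℤ) else 0
  have hB : B.det = 0 := by
    rw [← Matrix.exists_mulVec_eq_zero_iff]
    refine ⟨Fin.cons (-1) fun _ => 1, fun h => by simpa using congrFun h 0, ?_⟩
    ext i
    simp [Matrix.mulVec, dotProduct, Fin.sum_univ_succ, B]
  rw [Matrix.det_succ_column_zero] at hB
  rw [LinearMap.comp_apply, bd_single, map_sum, LinearMap.zero_apply, ← hB]
  refine Finset.sum_congr rfl fun i _ => ?_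
  rw [map_smul, orient_single, smul_eq_mul]
  simp only [B, Matrix.of_apply, Fin.cons_zero, mul_one]
  congr 2

lemma orient_cone_bd (a : Fin (n + 1)) (z : Chain (Fin (n + 1)) (n + 1)) :
    orient (n + 1) (cone a n (bd (Fin (n + 1)) n z)) = orient (n + 1) z := by
  have h := orient_bd (cone a (n + 1) z)
  rw [bd_cone, map_sub, sub_eq_zero] at h
  exact h.symm

end Orientation

section Counting

variable {n : ℕ}

/-- Faces shared by adjacent chambers cancel. -/
lemma sum_sign_smul_eq_zero {A : Type*} [AddCommGroup A] {ι : Type*} [Fintype ι] [DecidableEq ι]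
    (F : Equiv.Perm ι → A) {a b : ι} (hab : a ≠ b) (hF : ∀ σ, F (σ * Equiv.swap a b) = F σ) :
    ∑ σ : Equiv.Perm ι, (Equiv.Perm.sign σ : ℤ) • F σ = 0 := by
  refine Finset.sum_involution (fun σ _ => σ * Equiv.swap a b) (fun σ _ => ?_) (fun σ _ _ h => ?_)
    (fun _ _ => Finset.mem_univ _) (fun σ _ => ?_)
  · rw [hF, Equiv.Perm.sign_mul, Equiv.Perm.sign_swap hab]
    simp
  · rw [mul_eq_left, Equiv.Perm.one_def, Equiv.swap_eq_refl_iff] at h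
    exact hab h
  · rw [mul_assoc, Equiv.swap_mul_self, mul_one]

lemma sum_perm_eq_mul_sum_fiber (F : Equiv.Perm (Fin (n + 1)) → ℤ)
    (hF : ∀ t σ, F (Equiv.addRight t * σ) = F σ) (c a : Fin (n + 1)) :
    ∑ σ, F σ = (n + 1) * ∑ σ with σ c = a, F σ := by
  rw [← Finset.sum_fiberwise (Finset.univ) (fun σ : Equiv.Perm (Fin (n + 1)) => σ c) F]
  have h : ∀ b, ∑ σ with σ c = b, F σ = ∑ σ with σ c = a, F σ := fun b => by
    refine Finset.sum_equiv (Equiv.mulLeft (Equiv.addRight (a - b))) (fun σ => ?_) (fun σ _ => ?_)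
    · simp only [mem_filter, mem_univ, true_and, Equiv.coe_mulLeft, Equiv.Perm.mul_apply,
        Equiv.coe_addRight]
      constructor
      · rintro rfl; abel
      · intro h; rw [eq_sub_of_add_eq h]; abel
    · simp [hF]
  simp [h]

lemma card_perm_fiber (c a : Fin (n + 1)) :
    ((Finset.univ.filter fun σ : Equiv.Perm (Fin (n + 1)) => σ c = a).card : ℤ) = n.factorial := by
  have h := sum_perm_eq_mul_sum_fiber (n := n) (fun _ => 1) (fun _ _ => rfl) c a
  simp only [sum_const, card_univ, Fintype.card_perm, Fintype.card_fin, nsmul_eq_mul, mul_one,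
    Nat.factorial_succ] at h
  push_cast at h
  exact (mul_left_cancel₀ (by positivity) h).symm

end Counting

section Degree

variable {n : ℕ}

lemma sum_sign_orient_cone (a : Fin (n + 1)) :
    ∑ σ : Equiv.Perm (Fin (n + 1)), (Equiv.Perm.sign σ : ℤ) *
      orient (n + 1) (cone a n (Finsupp.single (fun j : Fin n => σ j.castSucc) 1)) =
    Equiv.Perm.sign (finRotate (n + 1)) * n.factorial := by
  rw [← card_perm_fiber (Fin.last n) a, Finset.card_filter, Nat.cast_sum, Finset.mul_sum]
  refine Finset.sum_congr rfl fun σ _ => ?_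
  rw [cone_single]
  split_ifs with h
  · have hv : (Fin.cons a fun j : Fin n => σ j.castSucc : Fin (n + 1) → Fin (n + 1)) =
        (σ * (finRotate (n + 1))⁻¹ : Equiv.Perm (Fin (n + 1))) := by
      funext i
      refine Fin.cases ?_ (fun j => ?_) i
      · rw [Fin.cons_zero, Equiv.Perm.mul_apply, ← h]
        congr 1
      · rw [Fin.cons_succ, Equiv.Perm.mul_apply]
        congr 1
        rw [Equiv.Perm.eq_inv_iff_eq, finRotate_apply, Fin.coeSucc_eq_succ]
    rw [hv, orient_single_perm, Equiv.Perm.sign_mul, Equiv.Perm.sign_inv]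
    push_cast
    rw [← mul_assoc, ← Units.val_mul, Int.units_mul_self]
    simp
  · rw [orient_single_eq_zero, mul_zero, Nat.cast_zero, mul_zero]
    intro hs
    have hi := Finite.injective_iff_surjective.2 hs
    obtain ⟨i, hi'⟩ := σ.surjective a
    have hil : i ≠ Fin.last n := fun h' => h (h' ▸ hi')
    obtain ⟨j, rfl⟩ := Fin.exists_castSucc_eq.2 hil
    have := @hi 0 j.succ (by simp [hi'])
    exact absurd this (Fin.succ_ne_zero j).symm

/-- Equivariant chain maps from the chessboard complex, given by compatible chain maps `Φ π` for
the placements `π` of the columns into the rows, which vanish on full simplices. -/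
theorem dvd_factorial_of_equivariant {n : ℕ}
    (Φ : (Fin (n + 2) → Fin (n + 2)) → ∀ m, Chain (Fin (n + 2)) m →ₗ[ℤ] Chain (Fin (n + 2)) m)
    (hbd : ∀ π m z, bd _ m (Φ π (m + 1) z) = Φ π m (bd _ m z))
    (hzero : ∀ π, Φ π 0 = LinearMap.id)
    (hloc : ∀ π π' m (v : Fin m → Fin (n + 2)), (∀ i, π (v i) = π' (v i)) →
      Φ π m (Finsupp.single v 1) = Φ π' m (Finsupp.single v 1))
    (hequiv : ∀ t π m z, Φ (Equiv.addRight t ∘ π) m z = push (Equiv.addRight t) m (Φ π m z))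
    (hfull : ∀ π : Fin (n + 2) → Fin (n + 2), (Function.Injective fun j : Fin (n + 1) => π j.castSucc) →
      orient (n + 2) (Φ π (n + 2)
        (Finsupp.single (Fin.cons (Fin.last (n + 1)) Fin.castSucc : Fin (n + 2) → Fin (n + 2)) 1))
        = 0) :
    n + 2 ∣ (n + 1).factorial := by
  classical
  let L : Fin (n + 1) → Fin (n + 2) := Fin.castSucc
  let c : Chain (Fin (n + 2)) (n + 1) := Finsupp.single L 1
  let H : (Fin (n + 2) → Fin (n + 2)) → ∀ m, Chain (Fin (n + 2)) m →ₗ[ℤ] Chain (Fin (n + 2)) (m + 1) :=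
    fun π => htpy π (Φ π) (push π)
  let s : Equiv.Perm (Fin (n + 2)) → ℤ := fun σ => Equiv.Perm.sign σ
  have hpush0 : ∀ π : Fin (n + 2) → Fin (n + 2), push π 0 = LinearMap.id := fun π =>
    chain_hom_ext fun v => by
      rw [push_single, LinearMap.id_apply, Subsingleton.elim (π ∘ v) v]
  have hH : ∀ π, bd _ (n + 1) (H π (n + 1) c) = Φ π (n + 1) c - push π (n + 1) c - H π n (bd _ n c) :=
    fun π => bd_htpy π _ _ (hbd π) (fun m z => bd_push π z) (by rw [hzero, hpush0]) c
  have hHloc : ∀ m π π' (v : Fin m → Fin (n + 2)), (∀ i, π (v i) = π' (v i)) →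
      H π m (Finsupp.single v 1) = H π' m (Finsupp.single v 1) := by
    intro m
    induction m with
    | zero => intros; rfl
    | succ m ih =>
      intro π π' v hv
      simp only [H] at ih ⊢
      rw [htpy_single, htpy_single, hloc π π' _ v hv, hv 0, push_single, push_single,
        show π ∘ v = π' ∘ v from funext hv, bd_single, map_sum, map_sum]
      simp only [map_smul]
      congr 2
      exact Finset.sum_congr rfl fun i _ => by rw [ih π π' _ fun j => hv _]
  have hHequiv : ∀ t π m z, H (Equiv.addRight t ∘ π) m z = push (Equiv.addRight t) (m + 1) (H π m z) := by
    intro t π m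
    induction m with
    | zero => intro z; simp [H, htpy]
    | succ m ih =>
      intro z
      suffices h : H (Equiv.addRight t ∘ π) (m + 1) = push (Equiv.addRight t) (m + 2) ∘ₗ H π (m + 1) from
        LinearMap.congr_fun h z
      refine chain_hom_ext fun v => ?_
      simp only [H] at ih ⊢
      rw [LinearMap.comp_apply, htpy_single, htpy_single, push_cone, ih, hequiv, map_sub (push _ _),
        map_sub (push _ _), push_push]
      rfl
  have hswap : ∀ (σ : Equiv.Perm (Fin (n + 2))) (i : Fin (n + 1)) (j : Fin n),
      (σ * Equiv.swap (L i) (Fin.last (n + 1))) (L (i.succAbove j)) = σ (L (i.succAbove j)) := by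
    intro σ i j
    rw [Equiv.Perm.mul_apply, Equiv.swap_apply_of_ne_of_ne]
    · exact fun h => Fin.succAbove_ne i j (Fin.castSucc_injective _ h)
    · exact (Fin.castSucc_lt_last _).ne
  have hcancel : ∀ (G : Equiv.Perm (Fin (n + 2)) → Chain (Fin (n + 2)) n →ₗ[ℤ] Chain (Fin (n + 2)) (n + 1)),
      (∀ σ i, G (σ * Equiv.swap (L i) (Fin.last (n + 1))) (Finsupp.single (fun j => L (i.succAbove j)) 1)
        = G σ (Finsupp.single (fun j => L (i.succAbove j)) 1)) →
      ∑ σ, s σ • G σ (bd _ n c) = 0 := by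
    intro G hG
    simp only [c, bd_single, map_sum, Finset.smul_sum, map_smul]
    rw [Finset.sum_comm]
    refine Finset.sum_eq_zero fun i _ => ?_
    simp only [smul_comm (s _) ((-1 : ℤ) ^ (i : ℕ))]
    rw [← Finset.smul_sum, sum_sign_smul_eq_zero _ (Fin.castSucc_lt_last i).ne fun σ => hG σ i,
      smul_zero]
  let e : Equiv.Perm (Fin (n + 2)) → Fin (n + 2) → Fin (n + 2) := fun σ =>
    Function.update σ (Fin.last (n + 1)) 0
  have he : ∀ σ j, e σ (L j) = σ (L j) := fun σ j =>
    Function.update_of_ne (Fin.castSucc_lt_last j).ne _ _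
  have heL : ∀ σ, e σ (Fin.last (n + 1)) = 0 := fun σ => Function.update_self _ _ _
  have hnull : orient (n + 2) (cone 0 (n + 1) (∑ σ, s σ • Φ σ (n + 1) c)) = 0 := by
    have h1 : ∀ σ, Φ (e σ) (n + 1) c = bd _ (n + 1) (Φ (e σ) (n + 2) (cone (Fin.last (n + 1)) (n + 1) c))
        + Φ (e σ) (n + 1) (cone (Fin.last (n + 1)) n (bd _ n c)) := fun σ => by
      rw [hbd, bd_cone, map_sub, sub_add_cancel]
    have h2 : ∀ σ : Equiv.Perm (Fin (n + 2)), Φ σ (n + 1) c = Φ (e σ) (n + 1) c := fun σ =>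
      hloc _ _ _ _ fun j => (he σ j).symm
    have h3 := hcancel (fun σ => Φ (e σ) (n + 1) ∘ₗ cone (Fin.last (n + 1)) n) (fun σ i => by
      simp only [LinearMap.comp_apply, cone_single]
      refine hloc _ _ _ _ fun j => ?_
      refine Fin.cases ?_ (fun j => ?_) j
      · simp only [Fin.cons_zero, heL]
      · simp only [Fin.cons_succ, he, hswap])
    simp only [LinearMap.comp_apply] at h3
    simp only [h2, h1, smul_add, Finset.sum_add_distrib, h3, add_zero]
    simp only [← map_smul, ← map_sum]
    rw [orient_cone_bd, map_sum]
    refine Finset.sum_eq_zero fun σ _ => ?_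
    rw [map_smul, map_smul, cone_single]
    refine ((orient (n + 2)).map_smul (s σ) _).trans <| (congrArg (s σ • ·) (hfull (e σ) ?_)).trans (smul_zero _)
    intro i j hij
    have hij' : e σ (L i) = e σ (L j) := hij
    rw [he, he] at hij'
    exact Fin.castSucc_injective _ (σ.injective hij')
  have hsum : ∑ σ, s σ • Φ σ (n + 1) c = ∑ σ : Equiv.Perm (Fin (n + 2)), s σ • push σ (n + 1) c +
      bd _ (n + 1) (∑ σ : Equiv.Perm (Fin (n + 2)), s σ • H σ (n + 1) c) := by
    have h3 := hcancel (fun σ => H σ n) (fun σ i => hHloc _ _ _ _ fun j => hswap σ i j)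
    simp only [map_sum, map_smul, hH, smul_sub, Finset.sum_sub_distrib, h3]
    abel
  rw [hsum, map_add, map_add, orient_cone_bd, map_sum, map_sum, map_sum] at hnull
  have hdeg : ∑ σ : Equiv.Perm (Fin (n + 2)), (Equiv.Perm.sign σ : ℤ) *
      orient (n + 2) (cone 0 (n + 1) (Finsupp.single (σ ∘ L) 1)) =
      Equiv.Perm.sign (finRotate (n + 2)) * (n + 1).factorial := sum_sign_orient_cone 0
  have hcong := sum_perm_eq_mul_sum_fiber (n := n + 1)
    (fun σ => s σ * orient (n + 2) (H σ (n + 1) c)) (fun t σ => by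
      rw [Equiv.Perm.coe_mul, hHequiv, orient_push_perm]
      simp only [s, Equiv.Perm.sign_mul]
      push_cast
      have := Int.units_mul_self (Equiv.Perm.sign (Equiv.addRight t : Equiv.Perm (Fin (n + 2))))
      have h : ((Equiv.Perm.sign (Equiv.addRight t : Equiv.Perm (Fin (n + 2))) : ℤˣ) : ℤ) *
        (Equiv.Perm.sign (Equiv.addRight t : Equiv.Perm (Fin (n + 2))) : ℤˣ) = 1 := by
        rw [← Units.val_mul, this, Units.val_one]
      linear_combination (Equiv.Perm.sign σ : ℤ) * orient (n + 2) (H σ (n + 1) c) * h) 0 0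
  simp only [map_smul, smul_eq_mul, c, push_single, s] at hnull hcong
  rw [hcong, hdeg] at hnull
  have hdvd : ((n + 2 : ℕ) : ℤ) ∣
      ((Equiv.Perm.sign (finRotate (n + 2)) : ℤˣ) : ℤ) * (n + 1).factorial := by
    rw [eq_neg_of_add_eq_zero_left hnull, dvd_neg,
      show ((n + 2 : ℕ) : ℤ) = ((n + 1 : ℕ) : ℤ) + 1 by push_cast; ring]
    exact dvd_mul_right _ _
  rw [Units.dvd_mul_left] at hdvd
  exact_mod_cast hdvd

end Degree

end OrderedChain

namespace Chessboard

open OrderedChain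

variable {r : ℕ}

/-- The configuration placing column `t` with weight `x t` in row `π t`. -/
def place (π : Fin r → Fin r) (x : Fin r → ℝ) : Fin r → Fin r → ℝ :=
  fun b t => if π t = b then x t else 0

lemma continuous_place (π : Fin r → Fin r) : Continuous (place π) := by
  refine continuous_pi fun b => continuous_pi fun t => ?_
  unfold place
  split_ifs <;> fun_prop

lemma place_comp (g : Equiv.Perm (Fin r)) (π : Fin r → Fin r) (x : Fin r → ℝ) :
    place (g ∘ π) x = rowPerm g (place π x) := by
  funext b t
  simp [place, rowPerm, Equiv.eq_symm_apply]

lemma place_congr {π π' : Fin r → Fin r} {x : Fin r → ℝ} (h : ∀ t, x t ≠ 0 → π t = π' t) :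
    place π x = place π' x := by
  funext b t
  by_cases hx : x t = 0
  · simp [place, hx]
  · simp [place, h t hx]

lemma place_mem {π : Fin r → Fin r}
    (hπ : ∀ t t' : Fin r, (t : ℕ) + 1 < r → (t' : ℕ) + 1 < r → π t = π t' → t = t')
    {x : Fin r → ℝ} (hx : x ∈ stdSimplex ℝ (Fin r)) : place π x ∈ ConfC1 r := by
  refine ⟨fun b t => ?_, ?_, fun t b b' h h' => ?_, fun b t t' ht ht' h h' => ?_⟩
  · unfold place
    split_ifs
    · exact hx.1 t
    · exact le_rfl
  · rw [Finset.sum_comm, ← hx.2]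
    simp [place]
  · simp only [place, ne_eq, ite_eq_right_iff, not_forall] at h h'
    exact h.1.symm.trans h'.1
  · simp only [place, ne_eq, ite_eq_right_iff, not_forall] at h h'
    exact hπ t t' ht ht' (h.1.trans h'.1.symm)

lemma rowPerm_inv_rowPerm (σ : Equiv.Perm (Fin r)) (M : Fin r → Fin r → ℝ) :
    rowPerm σ⁻¹ (rowPerm σ M) = M := by
  funext b t
  simp [rowPerm]

lemma rowPerm_mem {M : Fin r → Fin r → ℝ} (σ : Equiv.Perm (Fin r)) (h : M ∈ ConfC1 r) :
    rowPerm σ M ∈ ConfC1 r := by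
  obtain ⟨h1, h2, h3, h4⟩ := h
  refine ⟨fun b t => h1 _ t, ?_, fun t b b' h h' => σ⁻¹.injective (h3 t _ _ h h'),
    fun b t t' ht ht' h h' => h4 _ t t' ht ht' h h'⟩
  rw [← h2]
  exact Equiv.sum_comp σ⁻¹ fun b => ∑ t, M b t

lemma rowPerm_mem_iff {M : Fin r → Fin r → ℝ} (σ : Equiv.Perm (Fin r)) :
    rowPerm σ M ∈ ConfC1 r ↔ M ∈ ConfC1 r :=
  ⟨fun h => rowPerm_inv_rowPerm σ M ▸ rowPerm_mem σ⁻¹ h, rowPerm_mem σ⟩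

section Label

variable {n : ℕ} (f : (Fin (n + 1) → Fin (n + 1) → ℝ) → Fin (n + 1) → ℝ)

/-- A column of nonzero weight. -/
def pivot (x : Fin (n + 1) → ℝ) : Fin (n + 1) := Classical.epsilon fun t => x t ≠ 0

/-- An index at which `f` is nonnegative, chosen relative to the row of the pivot column, which
makes the choice equivariant under cyclic shifts of the rows. -/
def label (π : Fin (n + 1) → Fin (n + 1)) (x : Fin (n + 1) → ℝ) : Fin (n + 1) :=
  (Classical.epsilon fun k => 0 ≤ f (place π x) (k + π (pivot x))) + π (pivot x)

lemma label_nonneg {π : Fin (n + 1) → Fin (n + 1)} {x : Fin (n + 1) → ℝ}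
    (h : ∑ i, f (place π x) i = 0) : 0 ≤ f (place π x) (label f π x) := by
  refine Classical.epsilon_spec (p := fun k => 0 ≤ f (place π x) (k + π (pivot x))) ?_
  obtain ⟨i, -, hi⟩ := Finset.exists_le_of_sum_le (s := Finset.univ) Finset.univ_nonempty
    (f := fun _ => (0 : ℝ)) (g := f (place π x)) (by simp [h])
  exact ⟨i - π (pivot x), by simpa using hi⟩

lemma label_addRight (hf : ∀ (σ : Equiv.Perm (Fin (n + 1))) M, f (rowPerm σ M) = fun i => f M (σ⁻¹ i))
    (t : Fin (n + 1)) (π : Fin (n + 1) → Fin (n + 1)) (x : Fin (n + 1) → ℝ) :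
    label f (Equiv.addRight t ∘ π) x = Equiv.addRight t (label f π x) := by
  have h : ∀ k, (Equiv.addRight t)⁻¹ (k + (Equiv.addRight t ∘ π) (pivot x)) = k + π (pivot x) :=
    fun k => by
      rw [Equiv.Perm.inv_eq_iff_eq]
      simp [add_assoc]
  simp only [label, place_comp, hf, h]
  simp [add_assoc]

lemma label_congr {π π' : Fin (n + 1) → Fin (n + 1)} {x : Fin (n + 1) → ℝ} (hx : x ≠ 0)
    (h : ∀ t, x t ≠ 0 → π t = π' t) : label f π x = label f π' x := by
  have hp : x (pivot x) ≠ 0 := by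
    refine Classical.epsilon_spec (p := fun t => x t ≠ 0) ?_
    by_contra! h0
    exact hx (funext h0)
  rw [label, label, place_congr h, h _ hp]

/-- The chain map from simplices of columns, placed by `π`, to simplices of labels, after `N`
subdivisions. -/
def labelChain (N : ℕ) (π : Fin (n + 1) → Fin (n + 1)) (m : ℕ) :
    Chain (Fin (n + 1)) m →ₗ[ℤ] Chain (Fin (n + 1)) m :=
  push (label f π) m ∘ₗ (sd (Fin (n + 1) → ℝ) m ^ N) ∘ₗ push (fun t => Pi.single t 1) m

lemma labelChain_apply (N : ℕ) (π : Fin (n + 1) → Fin (n + 1)) (m : ℕ) (z : Chain (Fin (n + 1)) m) :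
    labelChain f N π m z =
      push (label f π) m ((sd _ m ^ N) (push (fun t => (Pi.single t 1 : Fin (n + 1) → ℝ)) m z)) :=
  rfl

lemma dist_single_le {ι : Type*} [Fintype ι] [DecidableEq ι] (s t : ι) :
    dist (Pi.single s 1 : ι → ℝ) (Pi.single t 1) ≤ 1 := by
  rw [dist_pi_le_iff zero_le_one]
  intro i
  simp only [Pi.single_apply]
  split_ifs <;> simp

lemma labelChain_congr (N : ℕ) {π π' : Fin (n + 1) → Fin (n + 1)} {m : ℕ}
    (v : Fin m → Fin (n + 1)) (h : ∀ i, π (v i) = π' (v i)) :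
    labelChain f N π m (Finsupp.single v 1) = labelChain f N π' m (Finsupp.single v 1) := by
  rw [labelChain_apply, labelChain_apply, push_single]
  refine map_eq_of_mem_supported (fun w hw => ?_)
    (sd_pow_single_mem_supported _ (fun i j => dist_single_le (v i) (v j)) N)
  rw [push_single, push_single]
  congr 1
  funext i
  have hS : Convex ℝ {x : Fin (n + 1) → ℝ | ∑ t, x t = 1 ∧ ∀ t ∉ Set.range v, x t = 0} := by
    rintro x ⟨hx1, hx2⟩ y ⟨hy1, hy2⟩ a b - - hab
    refine ⟨?_, fun t ht => ?_⟩
    · simp [Finset.sum_add_distrib, ← Finset.mul_sum, hx1, hy1, hab]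
    · simp [hx2 t ht, hy2 t ht]
  have hwi := convexHull_min (t := {x : Fin (n + 1) → ℝ | ∑ t, x t = 1 ∧ ∀ t ∉ Set.range v, x t = 0})
    (by
      rintro _ ⟨j, rfl⟩
      refine ⟨by simp, fun t ht => ?_⟩
      have : t ≠ v j := fun h => ht ⟨j, h.symm⟩
      simp [this]) hS (hw.1 i)
  refine label_congr f (fun h0 => ?_) fun t ht => ?_
  · have := hwi.1
    simp [h0] at this
  · by_contra hne
    refine ht (hwi.2 t ?_)
    rintro ⟨j, rfl⟩
    exact hne (h j)

/-- For fine subdivisions there are no fully labelled simplices. -/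
lemma eventually_orient_labelChain_eq_zero
    (hc : ContinuousOn f (ConfC1 (n + 1)))
    (hs : ∀ M ∈ ConfC1 (n + 1), (∑ i, f M i) = 0 ∧ ‖f M‖ = 1)
    {π : Fin (n + 1) → Fin (n + 1)} (hπ : Function.Injective fun j : Fin n => π j.castSucc)
    (v : Fin (n + 1) → Fin (n + 1)) :
    ∀ᶠ N in atTop, orient (n + 1) (labelChain f N π (n + 1) (Finsupp.single v 1)) = 0 := by
  have hmem : ∀ x ∈ stdSimplex ℝ (Fin (n + 1)), place π x ∈ ConfC1 (n + 1) := by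
    refine fun x hx => place_mem (fun t t' ht ht' h => ?_) hx
    have := @hπ ⟨t, by omega⟩ ⟨t', by omega⟩ h
    simpa [Fin.ext_iff] using this
  have hu : UniformContinuousOn (fun x => f (place π x)) (stdSimplex ℝ (Fin (n + 1))) :=
    (isCompact_stdSimplex ℝ _).uniformContinuousOn_of_continuous
      (hc.comp (continuous_place π).continuousOn hmem)
  rw [Metric.uniformContinuousOn_iff] at hu
  obtain ⟨δ, hδ, hu⟩ := hu (1 / ((n : ℝ) + 2)) (by positivity)
  have hlim : Tendsto (fun N : ℕ => (1 - (((n + 1 : ℕ) : ℝ))⁻¹) ^ N * 1) atTop (𝓝 0) := by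
    rw [← zero_mul (1 : ℝ)]
    refine (tendsto_pow_atTop_nhds_zero_of_lt_one ?_ ?_).mul_const 1
    · rw [sub_nonneg]
      exact inv_le_one_of_one_le₀ (by push_cast; linarith [n.cast_nonneg (α := ℝ)])
    · rw [sub_lt_self_iff]
      positivity
  filter_upwards [hlim.eventually (gt_mem_nhds hδ)] with N hN
  rw [labelChain_apply, push_single, ← LinearMap.comp_apply]
  refine map_eq_of_mem_supported (G := 0) (fun w hw => ?_)
    (sd_pow_single_mem_supported _ (fun i j => dist_single_le (v i) (v j)) N)
  rw [LinearMap.comp_apply, push_single, LinearMap.zero_apply]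
  refine orient_single_eq_zero fun hsurj => ?_
  have hwmem : ∀ i, w i ∈ stdSimplex ℝ (Fin (n + 1)) := fun i => by
    refine convexHull_min ?_ (convex_stdSimplex ℝ _) (hw.1 i)
    rintro _ ⟨j, rfl⟩
    exact single_mem_stdSimplex ℝ _
  obtain ⟨hsum, hnorm⟩ := hs _ (hmem _ (hwmem 0))
  have hlow : ∀ j, -(1 / ((n : ℝ) + 2)) ≤ f (place π (w 0)) j := fun j => by
    obtain ⟨i, rfl⟩ := hsurj j
    have h1 := label_nonneg f (hs _ (hmem _ (hwmem i))).1
    have h2 := hu _ (hwmem i) _ (hwmem 0) ((hw.2 i 0).trans_lt hN)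
    have h3 := (dist_le_pi_dist _ _ (label f π (w i))).trans h2.le
    rw [Real.dist_eq] at h3
    simp only [Function.comp_apply]
    linarith [(abs_le.1 h3).2]
  have hup : ∀ j, f (place π (w 0)) j ≤ n * (1 / ((n : ℝ) + 2)) := fun j => by
    rw [← Finset.add_sum_erase _ _ (Finset.mem_univ j)] at hsum
    have := Finset.card_nsmul_le_sum (Finset.univ.erase j) _ _ fun i _ => hlow i
    simp only [Finset.card_erase_of_mem (Finset.mem_univ j), card_univ, Fintype.card_fin,
      add_tsub_cancel_right, nsmul_eq_mul] at this
    linarith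
  have hlt : ‖f (place π (w 0))‖ ≤ ((n : ℝ) + 1) * (1 / ((n : ℝ) + 2)) := by
    rw [pi_norm_le_iff_of_nonneg (by positivity)]
    intro j
    have hpos : 0 ≤ 1 / ((n : ℝ) + 2) := by positivity
    have hpos' : 0 ≤ n * (1 / ((n : ℝ) + 2)) := by positivity
    rw [Real.norm_eq_abs, abs_le]
    constructor <;> linarith [hlow j, hup j]
  rw [hnorm, mul_one_div, le_div_iff₀ (by positivity)] at hlt
  linarith

end Label

lemma exists_total_equivariant {r : ℕ} (f : (Fin r → Fin r → ℝ) → Fin r → ℝ)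
    (hf : ∀ (σ : Equiv.Perm (Fin r)), ∀ M ∈ ConfC1 r,
      f (rowPerm σ M) = fun i => f M (σ⁻¹ i)) :
    ∃ F : (Fin r → Fin r → ℝ) → Fin r → ℝ, Set.EqOn F f (ConfC1 r) ∧
      ∀ (σ : Equiv.Perm (Fin r)) M, F (rowPerm σ M) = fun i => F M (σ⁻¹ i) := by
  classical
  refine ⟨(ConfC1 r).indicator f, Set.eqOn_indicator, fun σ M => ?_⟩
  by_cases hM : M ∈ ConfC1 r
  · rw [Set.indicator_of_mem (rowPerm_mem σ hM), Set.indicator_of_mem hM, hf σ M hM]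
  · rw [Set.indicator_of_notMem ((rowPerm_mem_iff σ).not.2 hM), Set.indicator_of_notMem hM]
    rfl

end Chessboard

lemma not_dvd_factorial_pred {r : ℕ} (hr : r.Prime ∨ r = 4) : ¬ r ∣ (r - 1).factorial := by
  rcases hr with hr | rfl
  · rw [hr.dvd_factorial]
    have := hr.pos
    omega
  · decide

end

open OrderedChain Chessboard in
/-- Nonexistence of equivariant maps from `Δ_{r,r-1} * [r]` to the sphere
`S^{r-2} = {y : Fin r → ℝ | ∑ i, y i = 0 ∧ ‖y‖ = 1}`, for `r` prime or
`r = 4`. -/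
theorem no_equivariant_map_C1_to_sphere (r : ℕ) (hr : r.Prime ∨ r = 4) :
    ¬ ∃ f : (Fin r → Fin r → ℝ) → (Fin r → ℝ),
      ContinuousOn f (ConfC1 r) ∧
      (∀ M ∈ ConfC1 r, (∑ i, f M i) = 0 ∧ ‖f M‖ = 1) ∧
      (∀ (σ : Equiv.Perm (Fin r)), ∀ M ∈ ConfC1 r,
        f (rowPerm σ M) = fun i => f M (σ⁻¹ i)) := by
  rintro ⟨f, hc, hs, hf⟩
  obtain ⟨n, rfl⟩ : ∃ n, r = n + 2 :=
    Nat.exists_eq_add_of_le' (hr.elim Nat.Prime.two_le (by omega))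
  obtain ⟨F, hFf, hF⟩ := exists_total_equivariant f hf
  have hev : ∀ᶠ N in Filter.atTop, ∀ π : Fin (n + 2) → Fin (n + 2),
      (Function.Injective fun j : Fin (n + 1) => π j.castSucc) →
      orient (n + 2) (labelChain F N π (n + 2)
        (Finsupp.single (Fin.cons (Fin.last (n + 1)) Fin.castSucc : Fin (n + 2) → Fin (n + 2)) 1))
        = 0 := by
    simp only [Filter.eventually_all]
    exact fun π hπ => eventually_orient_labelChain_eq_zero F (hc.congr hFf)
      (fun M hM => hFf hM ▸ hs M hM) hπ _
  obtain ⟨N, hN⟩ := hev.exists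
  refine not_dvd_factorial_pred hr (dvd_factorial_of_equivariant (labelChain F N)
    (fun π m z => ?_) (fun π => ?_) (fun π π' m v h => labelChain_congr F N v h)
    (fun t π m z => ?_) hN)
  · simp only [labelChain_apply, bd_push, bd_sd_pow]
  · refine chain_hom_ext fun v => ?_
    rw [labelChain_apply, sd, ← Module.End.one_eq_id, one_pow, Module.End.one_apply, push_single,
      push_single, LinearMap.id_apply]
    congr 1
    exact Subsingleton.elim _ _
  · rw [labelChain_apply, labelChain_apply, push_push]
    congr 2
    exact funext fun x => label_addRight F hF t π x
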